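/- Let U ⊂ ℝ^{d−1} be a bounded open set, L > 0, w : ℝ^{d−1} × ℝ → ℝ a C^∞ function, k ≥ 1 an integer, and τ : ℝ^{d−1} → ℝ a C^∞ function with τ > 0. Define the regulated volume F_τ(ε) = ∫_U ∫_{ε τ(x)}^{L} w(x,y) y^{−k} dy dx (for ε > 0 small enough that ε τ(x) < L on U). Then there exist real coefficients c_1(τ), ..., c_{k−1}(τ) and C(τ) such that, as ε → 0⁺, F_τ(ε) = Σ_{ℓ=1}^{k−1} c_ℓ(τ) ε^{−ℓ} + A · log ε + C(τ) + o(1), where the anomaly A = −(1/(k−1)!) ∫_U ∂_y^{k−1} w(x,0) dx is the same for every choice of regulator τ. -/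

import Mathlib

open MeasureTheory Filter Topology Set

/-- Partial derivatives in the second variable of a smooth function are jointly smooth. -/
theorem exists_contDiff_iteratedDeriv_snd {E : Type*} [NormedAddCommGroup E] [NormedSpace ℝ E]
    {w : E × ℝ → ℝ} (hw : ContDiff ℝ (⊤ : ℕ∞) w) (j : ℕ) :
    ∃ g : E × ℝ → ℝ, ContDiff ℝ (⊤ : ℕ∞) g ∧
      ∀ x, iteratedDeriv j (fun y => w (x, y)) = fun y => g (x, y) := by
  induction j with
  | zero => exact ⟨w, hw, fun x => by simp⟩
  | succ j ih =>
    obtain ⟨g, hg, hgw⟩ := ih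
    refine ⟨fun p => fderiv ℝ g p (0, 1), ?_, fun x => ?_⟩
    · exact (hg.fderiv_right (m := (⊤ : ℕ∞)) (by simp)).clm_apply contDiff_const
    · rw [iteratedDeriv_succ, hgw]
      funext y
      have hd : HasFDerivAt g (fderiv ℝ g (x, y)) (x, y) :=
        (hg.differentiable (by simp) _).hasFDerivAt
      exact (hd.comp_hasDerivAt y ((hasDerivAt_const y x).prodMk (hasDerivAt_id y))).deriv

/-- Taylor's theorem in the second variable, with remainder uniform over a compact set of
parameters. -/
theorem exists_taylor_snd_bound {E : Type*} [NormedAddCommGroup E] [NormedSpace ℝ E]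
    {w : E × ℝ → ℝ} (hw : ContDiff ℝ (⊤ : ℕ∞) w) {K : Set E} (hK : IsCompact K)
    {L : ℝ} (hL : 0 < L) (m : ℕ) :
    ∃ M : ℝ, ∀ x ∈ K, ∀ y ∈ Icc 0 L,
      |w (x, y) - ∑ j ∈ Finset.range (m + 1),
        iteratedDeriv j (fun y => w (x, y)) 0 / (j.factorial : ℝ) * y ^ j| ≤ M * y ^ (m + 1) := by
  obtain ⟨g, hg, hgw⟩ := exists_contDiff_iteratedDeriv_snd hw (m + 1)
  obtain ⟨B, hB⟩ := (hK.prod (isCompact_Icc (a := (0 : ℝ)) (b := L))).exists_bound_of_continuousOn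
    hg.continuous.continuousOn
  refine ⟨B / (m.factorial : ℝ), fun x hx y hy => ?_⟩
  have hwx : ContDiff ℝ (⊤ : ℕ∞) (fun y => w (x, y)) :=
    hw.comp (contDiff_const.prodMk contDiff_id)
  have hwithin (n : ℕ) (z : ℝ) (hz : z ∈ Icc 0 L) :
      iteratedDerivWithin n (fun y => w (x, y)) (Icc 0 L) z
        = iteratedDeriv n (fun y => w (x, y)) z :=
    iteratedDerivWithin_eq_iteratedDeriv (uniqueDiffOn_Icc hL)
      (hwx.contDiffAt.of_le (by exact_mod_cast le_top)) hz
  have key := taylor_mean_remainder_bound (f := fun y => w (x, y)) (n := m) (C := B) hL.le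
    (hwx.contDiffOn.of_le (by exact_mod_cast le_top)) hy (fun z hz => by
      rw [hwithin _ z hz, hgw]
      exact hB (x, z) ⟨hx, hz⟩)
  rw [taylor_within_apply, Real.norm_eq_abs] at key
  convert key using 1
  · congr 2
    refine Finset.sum_congr rfl fun j _ => ?_
    rw [hwithin j 0 (left_mem_Icc.2 hL.le)]
    simp only [sub_zero, smul_eq_mul]
    ring
  · rw [sub_zero]
    ring

theorem integral_one_div_pow_succ {b L : ℝ} (hb : 0 < b) (hL : 0 < L) {l : ℕ} (hl : 1 ≤ l) :
    ∫ y in b..L, 1 / y ^ (l + 1) = (1 / b ^ l - 1 / L ^ l) / l := by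
  have h0 : (0 : ℝ) ∉ uIcc b L := notMem_uIcc_of_lt hb hL
  have hl' : (l : ℝ) ≠ 0 := by exact_mod_cast (by omega : l ≠ 0)
  have h := integral_zpow (a := b) (b := L) (n := -((l : ℤ) + 1))
    (Or.inr ⟨by omega, h0⟩)
  have he : -((l : ℤ) + 1) + 1 = -(l : ℤ) := by ring
  have hc : ((-((l : ℤ) + 1) : ℤ) : ℝ) + 1 = -(l : ℝ) := by push_cast; ring
  have hf (y : ℝ) : 1 / y ^ (l + 1) = y ^ (-((l : ℤ) + 1)) := by
    rw [zpow_neg, one_div]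
    norm_cast
  rw [he, hc, zpow_neg, zpow_neg, zpow_natCast, zpow_natCast] at h
  simp_rw [hf]
  rw [h]
  field_simp
  ring

theorem stronglyMeasurable_integral_zero_to {E : Type*} [MeasurableSpace E] {ρ : E × ℝ → ℝ}
    (hρ : Measurable ρ) {b : E → ℝ} (hb : Measurable b) :
    StronglyMeasurable fun x => ∫ y in (0 : ℝ)..b x, ρ (x, y) := by
  have h (x : E) : ∫ y in (0 : ℝ)..b x, ρ (x, y)
      = b x * ∫ s in Ioc (0 : ℝ) 1, ρ (x, b x * s) := by
    have := intervalIntegral.smul_integral_comp_mul_left (a := 0) (b := 1)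
      (fun y => ρ (x, y)) (b x)
    rw [mul_zero, mul_one, smul_eq_mul] at this
    rw [← this, intervalIntegral.integral_of_le zero_le_one]
  simp_rw [h]
  refine hb.stronglyMeasurable.mul ?_
  have hm : Measurable fun p : E × ℝ => ρ (p.1, b p.1 * p.2) := by fun_prop
  exact hm.stronglyMeasurable.integral_prod_right'

theorem div_pow_eq_singular_add_remainder (v : ℝ) (a : ℕ → ℝ) (m : ℕ) {y : ℝ} (hy : y ≠ 0) :
    v / y ^ (m + 1) = (∑ l ∈ Finset.Icc 1 m, a (m - l) * (1 / y ^ (l + 1))) + a m * (1 / y)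
      + (v - ∑ j ∈ Finset.range (m + 1), a j * y ^ j) / y ^ (m + 1) := by
  have hs : ∑ l ∈ Finset.Icc 1 m, a (m - l) * (1 / y ^ (l + 1))
      = (∑ j ∈ Finset.range m, a j * y ^ j) / y ^ (m + 1) := by
    rw [Finset.sum_div]
    refine Finset.sum_nbij' (fun l => m - l) (fun j => m - j) ?_ ?_ ?_ ?_ ?_
    · intro l hl; simp at hl ⊢; omega
    · intro j hj; simp at hj ⊢; omega
    · intro l hl; simp at hl ⊢; omega
    · intro j hj; simp at hj ⊢; omega
    · intro l hl
      have hlm := (Finset.mem_Icc.1 hl).2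
      have : y ^ (m + 1) = y ^ (m - l) * y ^ (l + 1) := by
        rw [← pow_add]; congr 1; omega
      rw [this]
      field_simp
  rw [hs, Finset.sum_range_succ]
  field_simp
  ring

/-- The singular terms of the regulated one-dimensional integral of `f y / y ^ (m + 1)`, where
`f y = ∑ j ≤ m, a j * y ^ j + O(y ^ (m + 1))`. -/
theorem integral_div_pow_eq_singular_add_remainder {f : ℝ → ℝ} (hf : Continuous f) (a : ℕ → ℝ)
    {m : ℕ} {b L M : ℝ} (hb : 0 < b) (hbL : b ≤ L)
    (hM : ∀ y ∈ Icc 0 L,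
      |f y - ∑ j ∈ Finset.range (m + 1), a j * y ^ j| ≤ M * y ^ (m + 1)) :
    ∫ y in b..L, f y / y ^ (m + 1)
      = (∑ l ∈ Finset.Icc 1 m, a (m - l) * ((1 / b ^ l - 1 / L ^ l) / l))
        + a m * (Real.log L - Real.log b)
        + ((∫ y in (0 : ℝ)..L, (f y - ∑ j ∈ Finset.range (m + 1), a j * y ^ j) / y ^ (m + 1))
          - ∫ y in (0 : ℝ)..b,
            (f y - ∑ j ∈ Finset.range (m + 1), a j * y ^ j) / y ^ (m + 1)) := by
  have hL : 0 < L := hb.trans_le hbL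
  have hne : ∀ y ∈ uIcc b L, y ≠ 0 := fun y hy h =>
    notMem_uIcc_of_lt hb hL (h ▸ hy)
  set ρ : ℝ → ℝ := fun y => (f y - ∑ j ∈ Finset.range (m + 1), a j * y ^ j) / y ^ (m + 1)
  have hρm : Measurable ρ := by
    have := hf.measurable
    fun_prop
  have hρL : IntervalIntegrable ρ volume 0 L := by
    refine (intervalIntegrable_const (c := M)).mono_fun hρm.aestronglyMeasurable ?_
    rw [uIoc_of_le hL.le]
    refine (ae_restrict_mem measurableSet_Ioc).mono fun y hy => ?_
    have hyp : 0 < y ^ (m + 1) := pow_pos hy.1 _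
    refine le_trans ?_ (le_abs_self M)
    change |(f y - ∑ j ∈ Finset.range (m + 1), a j * y ^ j) / y ^ (m + 1)| ≤ M
    rw [abs_div, abs_of_pos hyp, div_le_iff₀ hyp]
    exact hM y ⟨hy.1.le, hy.2⟩
  have hρb : IntervalIntegrable ρ volume 0 b :=
    hρL.mono_set (by rw [uIcc_of_le hb.le, uIcc_of_le hL.le]; exact Icc_subset_Icc_right hbL)
  have hρbL : IntervalIntegrable ρ volume b L := hρb.symm.trans hρL
  have hpow (l : ℕ) : IntervalIntegrable (fun y => a (m - l) * (1 / y ^ (l + 1))) volume b L := by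
    refine ContinuousOn.intervalIntegrable fun y hy => ContinuousAt.continuousWithinAt ?_
    have := pow_ne_zero (l + 1) (hne y hy)
    fun_prop (disch := assumption)
  have hinv : IntervalIntegrable (fun y => a m * (1 / y)) volume b L := by
    refine ContinuousOn.intervalIntegrable fun y hy => ContinuousAt.continuousWithinAt ?_
    have := hne y hy
    fun_prop (disch := assumption)
  have hsum : IntervalIntegrable
      (fun y => ∑ l ∈ Finset.Icc 1 m, a (m - l) * (1 / y ^ (l + 1))) volume b L := by
    simpa only [Finset.sum_fn] using
      IntervalIntegrable.sum (Finset.Icc 1 m) fun l _ => hpow l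
  rw [intervalIntegral.integral_interval_sub_left hρL hρb,
    intervalIntegral.integral_congr fun y hy =>
      div_pow_eq_singular_add_remainder (f y) a m (hne y hy),
    intervalIntegral.integral_add (hsum.add hinv) hρbL,
    intervalIntegral.integral_add hsum hinv,
    intervalIntegral.integral_finsetSum fun l _ => hpow l,
    intervalIntegral.integral_const_mul, integral_one_div_of_pos hb hL,
    Real.log_div hL.ne' hb.ne']
  congr 2
  refine Finset.sum_congr rfl fun l hl => ?_
  rw [intervalIntegral.integral_const_mul,
    integral_one_div_pow_succ hb hL (Finset.mem_Icc.1 hl).1]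

/-- Asymptotic expansion of the regulated integral of a function with a uniform expansion
`w (x, y) = ∑ j ≤ m, a j x * y ^ j + O(y ^ (m + 1))`. -/
theorem exists_regulated_expansion {E : Type*} [NormedAddCommGroup E] [ProperSpace E]
    [MeasurableSpace E] [BorelSpace E] {μ : Measure E}
    [IsFiniteMeasureOnCompacts μ] {U : Set E} (hU : MeasurableSet U)
    (hUb : Bornology.IsBounded U) {L : ℝ} (hL : 0 < L) {w : E × ℝ → ℝ} (hw : Continuous w)
    {a : ℕ → E → ℝ} (ha : ∀ j, Continuous (a j)) {τ : E → ℝ} (hτ : Continuous τ)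
    (hτpos : ∀ x, 0 < τ x) {m : ℕ} {M : ℝ}
    (hM : ∀ x ∈ U, ∀ y ∈ Icc 0 L,
      |w (x, y) - ∑ j ∈ Finset.range (m + 1), a j x * y ^ j| ≤ M * y ^ (m + 1)) :
    ∃ (c : ℕ → ℝ) (C : ℝ), Tendsto (fun ε : ℝ =>
        (∫ x in U, (∫ y in (ε * τ x)..L, w (x, y) / y ^ (m + 1)) ∂μ)
        - (∑ ℓ ∈ Finset.Icc 1 m, c ℓ / ε ^ ℓ)
        - (-∫ x in U, a m x ∂μ) * Real.log ε - C) (𝓝[>] (0 : ℝ)) (𝓝 0) := by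
  have hint {g : E → ℝ} (hg : Continuous g) : IntegrableOn g U μ :=
    (hg.continuousOn.integrableOn_compact hUb.isCompact_closure).mono_set subset_closure
  have hUfin : μ U < ⊤ := hUb.measure_lt_top
  obtain ⟨T, hT⟩ := hUb.isCompact_closure.exists_bound_of_continuousOn hτ.continuousOn
  replace hT : ∀ x ∈ U, τ x ≤ T := fun x hx => (le_abs_self _).trans (hT x (subset_closure hx))
  set ρ : E × ℝ → ℝ := fun p =>
    (w p - ∑ j ∈ Finset.range (m + 1), a j p.1 * p.2 ^ j) / p.2 ^ (m + 1) with hρ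
  have hρm : Measurable ρ := by
    have := hw.measurable
    have := fun j => (ha j).measurable
    fun_prop
  have hbound {b B : ℝ} (hb : 0 ≤ b) (hbL : b ≤ L) (hbB : b ≤ B) {x : E} (hx : x ∈ U) :
      ‖∫ y in (0 : ℝ)..b, ρ (x, y)‖ ≤ |M| * B := by
    have h := intervalIntegral.norm_integral_le_of_norm_le_const (a := 0) (b := b) (C := |M|)
      (f := fun y => ρ (x, y)) fun y hy => by
        rw [uIoc_of_le hb] at hy
        have hyp : 0 < y ^ (m + 1) := pow_pos hy.1 _
        refine le_trans ?_ (le_abs_self M)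
        rw [hρ, Real.norm_eq_abs, abs_div, abs_of_pos hyp, div_le_iff₀ hyp]
        exact hM x hx y ⟨hy.1.le, hy.2.trans hbL⟩
    rw [sub_zero, abs_of_nonneg hb] at h
    exact h.trans (by gcongr)
  have hrem {b : E → ℝ} (hbm : Measurable b) (hb : ∀ x ∈ U, 0 ≤ b x ∧ b x ≤ L) :
      IntegrableOn (fun x => ∫ y in (0 : ℝ)..b x, ρ (x, y)) U μ :=
    IntegrableOn.of_bound hUfin (stronglyMeasurable_integral_zero_to hρm hbm).aestronglyMeasurable
      (|M| * L) ((ae_restrict_mem hU).mono fun x hx =>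
        hbound (hb x hx).1 (hb x hx).2 (hb x hx).2 hx)
  have hlog : Continuous fun x => a m x * Real.log (τ x) :=
    (ha m).mul (hτ.log fun x => (hτpos x).ne')
  have hpole (l : ℕ) : Continuous fun x => a (m - l) x / τ x ^ l / l :=
    ((ha _).div (hτ.pow l) fun x => pow_ne_zero l (hτpos x).ne').div_const _
  refine ⟨fun l => ∫ x in U, a (m - l) x / τ x ^ l / l ∂μ,
    -(∑ l ∈ Finset.Icc 1 m, (∫ x in U, a (m - l) x ∂μ) * (1 / L ^ l / l))
      + (∫ x in U, a m x ∂μ) * Real.log L - (∫ x in U, a m x * Real.log (τ x) ∂μ)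
      + ∫ x in U, (∫ y in (0 : ℝ)..L, ρ (x, y)) ∂μ, ?_⟩
  have hlim : Tendsto (fun ε : ℝ => |M| * (ε * T) * μ.real U) (𝓝[>] (0 : ℝ)) (𝓝 0) := by
    have : Continuous fun ε : ℝ => |M| * (ε * T) * μ.real U := by fun_prop
    simpa using (this.tendsto 0).mono_left nhdsWithin_le_nhds
  have hsmall : ∀ᶠ ε : ℝ in 𝓝[>] (0 : ℝ), ε * T < L := by
    have : Continuous fun ε : ℝ => ε * T := by fun_prop
    have h0 : Tendsto (fun ε : ℝ => ε * T) (𝓝[>] (0 : ℝ)) (𝓝 0) := by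
      simpa using (this.tendsto 0).mono_left nhdsWithin_le_nhds
    exact h0.eventually_lt_const hL
  refine squeeze_zero_norm' ?_ hlim
  filter_upwards [hsmall, self_mem_nhdsWithin] with ε hεT hε
  replace hε : 0 < ε := hε
  have hετ : ∀ x ∈ U, ε * τ x ≤ ε * T := fun x hx => by gcongr; exact hT x hx
  have hετL : ∀ x ∈ U, 0 ≤ ε * τ x ∧ ε * τ x ≤ L := fun x hx =>
    ⟨(mul_pos hε (hτpos x)).le, (hετ x hx).trans hεT.le⟩
  have hG := hrem (b := fun _ => L) measurable_const fun _ _ => ⟨hL.le, le_rfl⟩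
  have hH := hrem (b := fun x => ε * τ x) (by have := hτ.measurable; fun_prop) hετL
  have hpt : ∀ x ∈ U, ∫ y in (ε * τ x)..L, w (x, y) / y ^ (m + 1)
      = (∑ l ∈ Finset.Icc 1 m, (a (m - l) x / τ x ^ l / l * (1 / ε ^ l)
          - a (m - l) x * (1 / L ^ l / l)))
        + (a m x * (Real.log L - Real.log ε) - a m x * Real.log (τ x))
        + ((∫ y in (0 : ℝ)..L, ρ (x, y)) - ∫ y in (0 : ℝ)..(ε * τ x), ρ (x, y)) := by
    intro x hx
    rw [integral_div_pow_eq_singular_add_remainder (f := fun y => w (x, y))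
      (hw.comp (by fun_prop)) (fun j => a j x) (mul_pos hε (hτpos x)) (hετL x hx).2 (hM x hx),
      Real.log_mul hε.ne' (hτpos x).ne']
    congr 2
    · refine Finset.sum_congr rfl fun l _ => ?_
      rw [mul_pow]
      ring
    · ring
  have hterm (l : ℕ) : IntegrableOn (fun x => a (m - l) x / τ x ^ l / l * (1 / ε ^ l)
      - a (m - l) x * (1 / L ^ l / l)) U μ :=
    ((hint (hpole l)).mul_const _).sub ((hint (ha _)).mul_const _)
  have hI1 := integrable_finsetSum (Finset.Icc 1 m) fun l _ => hterm l
  have hI2 : IntegrableOn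
      (fun x => a m x * (Real.log L - Real.log ε) - a m x * Real.log (τ x)) U μ :=
    ((hint (ha m)).mul_const _).sub (hint hlog)
  have hI12 : IntegrableOn (fun x =>
      (∑ l ∈ Finset.Icc 1 m, (a (m - l) x / τ x ^ l / l * (1 / ε ^ l)
          - a (m - l) x * (1 / L ^ l / l)))
        + (a m x * (Real.log L - Real.log ε) - a m x * Real.log (τ x))) U μ := hI1.add hI2
  have hGH : IntegrableOn (fun x =>
      (∫ y in (0 : ℝ)..L, ρ (x, y)) - ∫ y in (0 : ℝ)..(ε * τ x), ρ (x, y)) U μ := hG.sub hH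
  have hsum : ∑ l ∈ Finset.Icc 1 m, ∫ x in U, (a (m - l) x / τ x ^ l / l * (1 / ε ^ l)
      - a (m - l) x * (1 / L ^ l / l)) ∂μ
      = (∑ l ∈ Finset.Icc 1 m, (∫ x in U, a (m - l) x / τ x ^ l / l ∂μ) / ε ^ l)
        - ∑ l ∈ Finset.Icc 1 m, (∫ x in U, a (m - l) x ∂μ) * (1 / L ^ l / l) := by
    rw [← Finset.sum_sub_distrib]
    refine Finset.sum_congr rfl fun l _ => ?_
    rw [integral_sub ((hint (hpole l)).mul_const _) ((hint (ha _)).mul_const _),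
      integral_mul_const, integral_mul_const, mul_one_div]
  have hF : ∫ x in U, (∫ y in (ε * τ x)..L, w (x, y) / y ^ (m + 1)) ∂μ
      = ((∑ l ∈ Finset.Icc 1 m, (∫ x in U, a (m - l) x / τ x ^ l / l ∂μ) / ε ^ l)
        - ∑ l ∈ Finset.Icc 1 m, (∫ x in U, a (m - l) x ∂μ) * (1 / L ^ l / l))
        + ((∫ x in U, a m x ∂μ) * (Real.log L - Real.log ε)
          - ∫ x in U, a m x * Real.log (τ x) ∂μ)
        + ((∫ x in U, (∫ y in (0 : ℝ)..L, ρ (x, y)) ∂μ)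
          - ∫ x in U, (∫ y in (0 : ℝ)..(ε * τ x), ρ (x, y)) ∂μ) := by
    rw [setIntegral_congr_fun hU hpt, integral_add hI12 hGH,
      integral_add hI1 hI2, integral_finsetSum _ fun l _ => hterm l, hsum,
      integral_sub ((hint (ha m)).mul_const _) (hint hlog), integral_mul_const,
      integral_sub hG hH]
  have hHbound := norm_setIntegral_le_of_norm_le_const hUfin fun x hx =>
    hbound (hετL x hx).1 (hετL x hx).2 (hετ x hx) hx
  rw [← norm_neg] at hHbound
  convert hHbound using 2
  rw [hF]
  ring

/-- Regulator-independence of the anomaly (Theorem 2.2) in the product-chart model: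
for any smooth positive regulator `τ`, the regulated volume
`F_τ(ε) = ∫_U ∫_{ετ(x)}^L w(x,y) y^{-k} dy dx` has an asymptotic expansion as
`ε → 0⁺` whose `log ε` coefficient is the fixed anomaly
`A = -(1/(k-1)!) ∫_U ∂_y^{k-1} w(x,0) dx`, the same for every choice of `τ`. -/
theorem stmt3 (d : ℕ) (U : Set (EuclideanSpace ℝ (Fin (d-1)))) (hU : IsOpen U)
    (hUb : Bornology.IsBounded U) (L : ℝ) (hL : 0 < L)
    (w : EuclideanSpace ℝ (Fin (d-1)) × ℝ → ℝ) (hw : ContDiff ℝ (⊤ : ℕ∞) w)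
    (k : ℕ) (hk : 1 ≤ k)
    (τ : EuclideanSpace ℝ (Fin (d-1)) → ℝ) (hτ : ContDiff ℝ (⊤ : ℕ∞) τ)
    (hτpos : ∀ x, 0 < τ x) :
    ∃ (c : ℕ → ℝ) (C : ℝ), Filter.Tendsto (fun ε : ℝ =>
        (∫ x in U, ∫ y in (ε * τ x)..L, w (x, y) / y ^ k)
        - (∑ ℓ ∈ Finset.Icc 1 (k-1), c ℓ / ε ^ ℓ)
        - (-(1 / ((k-1).factorial : ℝ))
            * ∫ x in U, iteratedDeriv (k-1) (fun y => w (x, y)) 0) * Real.log ε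
        - C)
      (𝓝[>] (0:ℝ)) (𝓝 0) := by
  obtain ⟨m, rfl⟩ : ∃ m, k = m + 1 := ⟨k - 1, by omega⟩
  simp only [Nat.add_sub_cancel]
  have hcont (j : ℕ) : Continuous fun x =>
      iteratedDeriv j (fun y => w (x, y)) 0 / (j.factorial : ℝ) := by
    obtain ⟨g, hg, hgw⟩ := exists_contDiff_iteratedDeriv_snd hw j
    simp only [hgw]
    have := hg.continuous
    fun_prop
  obtain ⟨M, hM⟩ := exists_taylor_snd_bound hw hUb.isCompact_closure hL m
  obtain ⟨c, C, h⟩ := exists_regulated_expansion (μ := volume) hU.measurableSet hUb hL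
    hw.continuous hcont hτ.continuous hτpos fun x hx => hM x (subset_closure hx)
  refine ⟨c, C, ?_⟩
  rw [integral_div] at h
  simpa only [one_div_mul_eq_div, neg_mul] using h
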